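/- For all positive integers q and n, the following identity holds in the polynomial ring ℤ[t₁, t₂]: Σ_{π ∈ S_{n+q−1}} t₁^{rmaj_{q,n+q−1}(π)} t₂^{#Del_q(π)} = Σ_{π ∈ S_{n+q−1}} t₁^{inv_q(π)} t₂^{#Del_q(π)} = q! · ∏_{j=1}^{n−1} (1 + t₁ + t₁² + ⋯ + t₁^{j−1} + t₁^{j} t₂ q). -/

import Mathlib

open Finset

/-- The Coxeter generator `s_j = (j, j+1)` of the symmetric group on `{1,…,m}`,
viewed as a permutation of `ℕ` (with 1-based positions). -/
def sgen (j : ℕ) : Equiv.Perm ℕ := Equiv.swap j (j + 1)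

/-- The permutation determined by a word in the Coxeter generators,
letters read from left to right and composed as functions. -/
def wordPerm (L : List ℕ) : Equiv.Perm ℕ := (L.map sgen).prod

/-- The canonical presentation of a permutation of `{1,…,m}` (given as a permutation of `ℕ`
supported on `{1,…,m}`): the unique factorization `w = w₁ w₂ ⋯ w_{m-1}` with
`w_j ∈ R_j = {1, s_j, s_j s_{j-1}, …, s_j ⋯ s_1}`, recorded as the list of indices of the
Coxeter generators appearing, read from left to right. -/
def canonWord : ℕ → Equiv.Perm ℕ → List ℕ
  | 0, _ => []
  | m + 1, π =>
      canonWord m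
          (π * (wordPerm ((List.range' (π⁻¹ (m + 1)) (m + 1 - π⁻¹ (m + 1))).reverse))⁻¹)
        ++ (List.range' (π⁻¹ (m + 1)) (m + 1 - π⁻¹ (m + 1))).reverse

def finIccEquiv (m : ℕ) : Fin m ≃ {i : ℕ // i ∈ Finset.Icc 1 m} where
  toFun a := ⟨a.1 + 1, by have := a.isLt; simp only [Finset.mem_Icc]; omega⟩
  invFun b := ⟨b.1 - 1, by have := b.2; simp only [Finset.mem_Icc] at this; omega⟩
  left_inv a := by ext; simp
  right_inv b := by
    have := b.2
    simp only [Finset.mem_Icc] at this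
    ext
    simp only []
    omega

/-- A permutation of `{1,…,m}`, i.e. of `Fin m`, viewed as a permutation of `ℕ`
(moving only the points `1,…,m`, with `i ∈ Fin m` corresponding to the point `i+1`). -/
def natPerm {m : ℕ} (π : Equiv.Perm (Fin m)) : Equiv.Perm ℕ :=
  π.extendDomain (finIccEquiv m)

/-- `Del_q` of a permutation of `{1,…,m}`: the set of positions `q+1 ≤ i ≤ m` that are
`(q-1)`-st almost left-to-right minima, i.e. `#{j < i : π(j) < π(i)} ≤ q - 1`. -/
def DelQ (q m : ℕ) (π : Equiv.Perm ℕ) : Finset ℕ :=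
  (Finset.Icc (q + 1) m).filter fun i =>
    ((Finset.Ico 1 i).filter fun j => π j < π i).card ≤ q - 1

/-- The descent set of a permutation of `{1,…,m}`: positions `1 ≤ i ≤ m-1` with `π(i) > π(i+1)`. -/
def DesSet (m : ℕ) (π : Equiv.Perm ℕ) : Finset ℕ :=
  (Finset.Icc 1 (m - 1)).filter fun i => π (i + 1) < π i

/-- `Des_q(π) = (Des(π) ∩ {q,…,m-1}) ∪ (Del_q(π) - 1)`. -/
def DesQ (q m : ℕ) (π : Equiv.Perm ℕ) : Finset ℕ :=
  DesSet m π ∩ Finset.Icc q (m - 1) ∪ (DelQ q m π).image (fun i => i - 1)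

/-- The `q`-inversion number of a permutation of `{1,…,m}`:
`inv_q(π) = Σ_{i=q+1}^m min(i-q, #{j < i : π(j) > π(i)})`. -/
def invQ (q m : ℕ) (π : Equiv.Perm ℕ) : ℕ :=
  ∑ i ∈ Finset.Icc (q + 1) m,
    min (i - q) ((Finset.Ico 1 i).filter fun j => π i < π j).card

/-- The `q`-reverse major index `rmaj_{q,m}(π) = Σ_{i ∈ Des_q(π)} (m - i)`. -/
def rmajQ (q m : ℕ) (π : Equiv.Perm ℕ) : ℕ :=
  ∑ i ∈ DesQ q m π, (m - i)

/-- The `q`-length of a permutation of `{1,…,m}`: the number of letters in the canonical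
presentation, where the generators `s_1, …, s_{q-1}` are not counted. -/
def ellQ (q m : ℕ) (π : Equiv.Perm ℕ) : ℕ :=
  ((canonWord m π).filter fun j => q ≤ j).length

/-- `del_q` of a permutation of `{1,…,m}`: the number of occurrences of the generator `s_q`
in the canonical presentation. -/
def delq (q m : ℕ) (π : Equiv.Perm ℕ) : ℕ := (canonWord m π).count q

/-- The covering map `f_q : S_m → S_{m-q+1}`, defined on the canonical presentation by
`s_j ↦ 1` if `j ≤ q-1` and `s_j ↦ s_{j-q+1}` if `j ≥ q`. -/
def fq (q m : ℕ) (π : Equiv.Perm ℕ) : Equiv.Perm ℕ :=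
  wordPerm (((canonWord m π).filter fun j => q ≤ j).map fun j => j - q + 1)

/-- A permutation of `{1,…,m}` avoids the pattern set `Pat(q)` iff there is no sequence
`1 ≤ i₁ < i₂ < ⋯ < i_{q+1} < m` with `π(i_{q+1}) > π(i_{q+1}+1)` and
`π(i_j) < π(i_{q+1}+1)` for all `1 ≤ j ≤ q`. -/
def AvoidsPat (q m : ℕ) (π : Equiv.Perm ℕ) : Prop :=
  ¬ ∃ f : Fin (q + 1) → ℕ, StrictMono f ∧ 1 ≤ f 0 ∧ f (Fin.last q) < m ∧
      π (f (Fin.last q) + 1) < π (f (Fin.last q)) ∧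
      ∀ a : Fin (q + 1), a ≠ Fin.last q → π (f a) < π (f (Fin.last q) + 1)

/-- The Stirling number of the second kind `S(n,k)`: the number of partitions of
`{1,…,n}` into `k` nonempty blocks. -/
noncomputable def stirling2 (n k : ℕ) : ℕ :=
  Nat.card {P : Finpartition (Finset.univ : Finset (Fin n)) // P.parts.card = k}

/-- The `q`-Bell number `b_q(n) = Σ_k q^k S(n,k)`. -/
noncomputable def qBell (q n : ℕ) : ℕ := ∑ k ∈ Finset.range (n + 1), q ^ k * stirling2 n k

/-- `h_q(m)`: the number of permutations of `{1,…,m}` avoiding all patterns in `Pat(q)`. -/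
noncomputable def hq (q m : ℕ) : ℕ :=
  Nat.card {π : Equiv.Perm (Fin m) // AvoidsPat q m (natPerm π)}

/-- The number of cycles (including fixed points) of a permutation of `{1,…,n}`. -/
def cycleCount {n : ℕ} (σ : Equiv.Perm (Fin n)) : ℕ :=
  σ.cycleType.card + (n - σ.support.card)

/-- The signless Stirling number of the first kind `c(n,k)`: the number of permutations
of `{1,…,n}` with exactly `k` cycles. -/
noncomputable def stirling1 (n k : ℕ) : ℕ :=
  Nat.card {σ : Equiv.Perm (Fin n) // cycleCount σ = k}

/-- The weight of a letter `d` following the letter `c` in the code of a permutation, when a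
descent at this place contributes `s` to the reverse major index. -/
def codeStep {R : Type*} [CommRing R] (q : ℕ) (t y : R) (s c d : ℕ) : R :=
  (if d < q then y else 1) * (if d < q ∨ d ≤ c then t ^ s else 1)

/-- The sum of the weights of all continuations by `r` letters of a code of length `k` whose last
letter is `c`. -/
def codeTail {R : Type*} [CommRing R] (q : ℕ) (t y : R) : ℕ → ℕ → ℕ → R
  | 0, _, _ => 1
  | r + 1, k, c =>
      ∑ d ∈ range (k + 1), codeStep q t y (r + 1) c d * codeTail q t y r (k + 1) d

section CodeTail

variable {R : Type*} [CommRing R] (q : ℕ) (t y : R)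

theorem codeTail_succ_of_le (r k c : ℕ) (hqk : q ≤ k + 1) (hc : c ≤ k) :
    codeTail q t y (r + 1) (k + 1) c =
      codeTail q t y (r + 1) k c +
        (∑ i ∈ range (r + 1), t ^ i) * codeTail q t y r (k + 1) c := by
  have hlast : ∀ s, codeStep q t y s c (k + 1) = 1 := by
    intro s
    have h1 : ¬ k + 1 < q := by omega
    have h2 : ¬ k + 1 ≤ c := by omega
    simp [codeStep, h1, h2]
  induction r generalizing k c with
  | zero => simp [codeTail, sum_range_succ _ (k + 1), hlast]
  | succ r ih =>
    have hrec : ∀ d ∈ range (k + 1 + 1),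
        codeStep q t y (r + 1 + 1) c d * codeTail q t y (r + 1) (k + 1 + 1) d =
          codeStep q t y (r + 1 + 1) c d * codeTail q t y (r + 1) (k + 1) d +
          (∑ i ∈ range (r + 1), t ^ i) *
            (codeStep q t y (r + 1 + 1) c d * codeTail q t y r (k + 1 + 1) d) := by
      intro d hd
      have hd' : d ≤ k + 1 := by simpa [Nat.lt_succ_iff] using hd
      rw [ih (k + 1) d (by omega) hd']
      · ring
      · intro s
        have h1 : ¬ k + 1 + 1 < q := by omega
        have h2 : ¬ k + 1 + 1 ≤ d := by omega
        simp [codeStep, h1, h2]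
    have hunfold : ∀ r k c, codeTail q t y (r + 1) k c =
      ∑ d ∈ range (k + 1), codeStep q t y (r + 1) c d * codeTail q t y r (k + 1) d :=
        fun _ _ _ => rfl
    rw [hunfold (r + 1) (k + 1) c, sum_congr rfl hrec, sum_add_distrib, ← mul_sum,
      sum_range_succ _ (k + 1), hlast, one_mul, hunfold (r + 1) k c, add_assoc]
    congr 1
    rw [hunfold r (k + 1) (k + 1), hunfold r (k + 1) c, mul_sum, mul_sum, ← sum_add_distrib]
    refine sum_congr rfl fun d hd => ?_
    have hd' : d ≤ k + 1 := by simpa [Nat.lt_succ_iff] using hd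
    have hgeom : (∑ i ∈ range (r + 1 + 1), t ^ i) = (∑ i ∈ range (r + 1), t ^ i) * t + 1 := by
      rw [sum_range_succ', sum_mul]
      simp [pow_succ]
    have hgeom' := sum_range_succ (fun i => t ^ i) (r + 1)
    by_cases hdc : d < q ∨ d ≤ c
    · simp only [codeStep, hdc, hd', or_true, if_true]
      rw [hgeom]
      ring
    · simp only [codeStep, hdc, hd', or_true, if_true, if_false]
      rw [hgeom']
      ring

theorem codeTail_eq_of_lt (r k c c' : ℕ) (hc : c < q) (hc' : c' < q) :
    codeTail q t y r k c = codeTail q t y r k c' := by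
  cases r with
  | zero => rfl
  | succ r =>
    refine sum_congr rfl fun d _ => ?_
    have h : (d < q ∨ d ≤ c) ↔ (d < q ∨ d ≤ c') := by omega
    simp only [codeStep, h]

theorem codeTail_self (r c : ℕ) (hc : c < q) :
    codeTail q t y r q c =
      ∏ j ∈ Icc 1 r, ((∑ i ∈ range j, t ^ i) + t ^ j * y * (q : R)) := by
  induction r with
  | zero => simp [codeTail]
  | succ r ih =>
    obtain ⟨p, rfl⟩ : ∃ p, q = p + 1 := ⟨q - 1, by omega⟩
    have hfirst : codeTail (p + 1) t y (r + 1) p c =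
        t ^ (r + 1) * y * ((p + 1 : ℕ) : R) * codeTail (p + 1) t y r (p + 1) c := by
      have hterm : ∀ d ∈ range (p + 1),
          codeStep (p + 1) t y (r + 1) c d * codeTail (p + 1) t y r (p + 1) d =
            y * t ^ (r + 1) * codeTail (p + 1) t y r (p + 1) c := by
        intro d hd
        have hd' : d < p + 1 := mem_range.1 hd
        rw [codeTail_eq_of_lt _ _ _ _ _ d c hd' hc]
        simp [codeStep, hd']
      rw [codeTail, sum_congr rfl hterm, sum_const, card_range, nsmul_eq_mul]
      ring
    rw [codeTail_succ_of_le _ _ _ r p c le_rfl (by omega), hfirst, ih,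
      prod_Icc_succ_top (by omega)]
    ring

end CodeTail

open scoped Classical in
/-- The sequences `a` with `a i ≤ i` for `i < m`, extended by zero. -/
noncomputable def codes : ℕ → Finset (ℕ → ℕ)
  | 0 => {fun _ => 0}
  | m + 1 => (codes m ×ˢ range (m + 1)).image fun x => Function.update x.1 m x.2

theorem mem_codes {m : ℕ} {a : ℕ → ℕ} :
    a ∈ codes m ↔ (∀ i < m, a i ≤ i) ∧ ∀ i, m ≤ i → a i = 0 := by
  induction m generalizing a with
  | zero =>
    simp only [codes, mem_singleton]
    exact ⟨fun h => by simp [h], fun h => funext fun i => h.2 i (Nat.zero_le _)⟩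
  | succ m ih =>
    simp only [codes, mem_image, mem_product, mem_range, Prod.exists]
    constructor
    · rintro ⟨b, c, ⟨hb, hc⟩, rfl⟩
      rw [ih] at hb
      refine ⟨fun i hi => ?_, fun i hi => ?_⟩
      · rcases eq_or_ne i m with rfl | h
        · simpa using Nat.lt_succ_iff.1 hc
        · simpa [h] using hb.1 i (by omega)
      · have h : i ≠ m := by omega
        simpa [h] using hb.2 i (by omega)
    · rintro ⟨h1, h2⟩
      refine ⟨Function.update a m 0, a m, ⟨?_, Nat.lt_succ_iff.2 (h1 m (by omega))⟩, by simp⟩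
      rw [ih]
      refine ⟨fun i hi => ?_, fun i hi => ?_⟩
      · have h : i ≠ m := by omega
        simpa [h] using h1 i (by omega)
      · rcases eq_or_ne i m with rfl | h
        · simp
        · simpa [h] using h2 i (by omega)

theorem sum_codes_succ {M : Type*} [AddCommMonoid M] (m : ℕ) (f : (ℕ → ℕ) → M) :
    ∑ a ∈ codes (m + 1), f a =
      ∑ a ∈ codes m, ∑ c ∈ range (m + 1), f (Function.update a m c) := by
  classical
  rw [codes, sum_image, sum_product]
  rintro ⟨a, c⟩ hac ⟨b, d⟩ hbd h
  simp only [coe_product, Set.mem_prod, mem_coe, mem_codes] at hac hbd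
  have hcd : c = d := by simpa using congrFun h m
  refine Prod.ext (funext fun i => ?_) hcd
  rcases eq_or_ne i m with rfl | hi
  · exact (hac.1.2 _ le_rfl).trans (hbd.1.2 _ le_rfl).symm
  · simpa [hi] using congrFun h i

theorem card_codes (m : ℕ) : (codes m).card = m.factorial := by
  induction m with
  | zero => simp [codes]
  | succ m ih =>
    rw [card_eq_sum_ones, sum_codes_succ]
    simp [ih, Nat.factorial_succ, mul_comm]

/-- Evaluation of a sum over codes whose weight is a product of contributions of consecutive
letters, by means of a transfer recursion for the sums over continuations. -/
theorem sum_codes_eq_factorial_mul {R : Type*} [CommRing R] {q m : ℕ} (hq : 0 < q) (hm : q ≤ m)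
    (h : ℕ → ℕ → ℕ → R) (G : ℕ → ℕ → R) (C : R)
    (hG : ∀ k c, q ≤ k → k < m → G k c = ∑ d ∈ range (k + 1), h k c d * G (k + 1) d)
    (htop : ∀ c, G m c = 1) (hbot : ∀ c < q, G q c = C) :
    ∑ a ∈ codes m, ∏ i ∈ Ico q m, h i (a (i - 1)) (a i) = (q.factorial : R) * C := by
  have key : ∀ k, q ≤ k → k ≤ m →
      ∑ a ∈ codes k, (∏ i ∈ Ico q k, h i (a (i - 1)) (a i)) * G k (a (k - 1)) =
        (q.factorial : R) * C := by
    intro k hk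
    induction k, hk using Nat.le_induction with
    | base =>
      intro _
      have hterm : ∀ a ∈ codes q,
          (∏ i ∈ Ico q q, h i (a (i - 1)) (a i)) * G q (a (q - 1)) = C := by
        intro a ha
        have := (mem_codes.1 ha).1 (q - 1) (by omega)
        simp [hbot (a (q - 1)) (by omega)]
      rw [sum_congr rfl hterm, sum_const, card_codes, nsmul_eq_mul]
    | succ k hk ih =>
      intro hkm
      rw [← ih (by omega), sum_codes_succ]
      refine sum_congr rfl fun a _ => ?_
      rw [hG k _ hk (by omega), mul_sum]
      refine sum_congr rfl fun c _ => ?_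
      have hprod : ∏ i ∈ Ico q k,
          h i (Function.update a k c (i - 1)) (Function.update a k c i) =
          ∏ i ∈ Ico q k, h i (a (i - 1)) (a i) := by
        refine prod_congr rfl fun i hi => ?_
        rw [mem_Ico] at hi
        rw [Function.update_of_ne (by omega), Function.update_of_ne (by omega)]
      rw [prod_Ico_succ_top hk, hprod, Function.update_of_ne (by omega)]
      simp [mul_assoc]
  simpa [htop] using key m hm le_rfl

/-- The number of positions `1 ≤ j < i` with `f j < f i`. -/
def smallerBefore (f : ℕ → ℕ) (i : ℕ) : ℕ := ((Ico 1 i).filter fun j => f j < f i).card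

theorem smallerBefore_lt (f : ℕ → ℕ) {i : ℕ} (hi : 1 ≤ i) : smallerBefore f i < i := by
  have := card_filter_le (Ico 1 i) fun j => f j < f i
  rw [Nat.card_Ico] at this
  rw [smallerBefore]
  omega

theorem card_filter_lt_of_injective {f : ℕ → ℕ} (hf : f.Injective) (i : ℕ) :
    ((Ico 1 i).filter fun j => f i < f j).card = i - 1 - smallerBefore f i := by
  have h := card_filter_add_card_filter_not (s := Ico 1 i) (fun j => f j < f i)
  have h' : ((Ico 1 i).filter fun j => ¬ f j < f i) = (Ico 1 i).filter fun j => f i < f j := by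
    refine filter_congr fun j hj => ?_
    have : f j ≠ f i := hf.ne (by rw [mem_Ico] at hj; omega)
    omega
  rw [h', Nat.card_Ico] at h
  rw [smallerBefore]
  omega

theorem apply_succ_lt_iff_smallerBefore_le {f : ℕ → ℕ} (hf : f.Injective) {i : ℕ} (hi : 1 ≤ i) :
    f (i + 1) < f i ↔ smallerBefore f (i + 1) ≤ smallerBefore f i := by
  constructor
  · intro h
    refine card_le_card fun j hj => ?_
    simp only [mem_filter, mem_Ico] at hj ⊢
    have : j ≠ i := by rintro rfl; omega
    omega
  · intro h
    by_contra hlt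
    have hne : f i ≠ f (i + 1) := hf.ne (by omega)
    refine absurd h (not_le.2 (card_lt_card ((ssubset_iff_of_subset fun j hj => ?_).2
      ⟨i, ?_, ?_⟩)))
    · simp only [mem_filter, mem_Ico] at hj ⊢
      omega
    · simp only [mem_filter, mem_Ico]
      omega
    · simp

theorem lt_of_smallerBefore_eq {f g : ℕ → ℕ} (hg : g.Injective) {k j : ℕ}
    (hj : 1 ≤ j) (hjk : j < k) (hk : smallerBefore f k = smallerBefore g k)
    (hord : ∀ i, 1 ≤ i → i < k → (f j < f i ↔ g j < g i)) (h : f j < f k) : g j < g k := by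
  by_contra hlt
  have hne : g j ≠ g k := hg.ne (by omega)
  refine absurd hk (ne_of_gt ?_)
  refine card_lt_card ((ssubset_iff_of_subset fun i hi => ?_).2 ⟨j, ?_, ?_⟩)
  · simp only [mem_filter, mem_Ico] at hi ⊢
    have := hord i hi.1.1 hi.1.2
    omega
  · simp only [mem_filter, mem_Ico]
    omega
  · simp only [mem_filter, mem_Ico]
    omega

theorem lt_iff_lt_of_smallerBefore_eq {f g : ℕ → ℕ} (hf : f.Injective) (hg : g.Injective)
    (m : ℕ) (h : ∀ i, 1 ≤ i → i ≤ m → smallerBefore f i = smallerBefore g i) :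
    ∀ i j, 1 ≤ i → i ≤ m → 1 ≤ j → j ≤ m → (f i < f j ↔ g i < g j) := by
  induction m with
  | zero => intros; omega
  | succ m ih =>
    have ih' := ih fun i h1 h2 => h i h1 (by omega)
    have hlast := h (m + 1) (by omega) le_rfl
    have key : ∀ j, 1 ≤ j → j ≤ m → (f j < f (m + 1) ↔ g j < g (m + 1)) := fun j h1 h2 =>
      ⟨lt_of_smallerBefore_eq hg h1 (by omega) hlast
          fun i h3 h4 => ih' j i h1 h2 h3 (by omega),
        lt_of_smallerBefore_eq hf h1 (by omega) hlast.symm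
          fun i h3 h4 => (ih' j i h1 h2 h3 (by omega)).symm⟩
    intro i j hi him hj hjm
    rcases Nat.lt_or_ge m i with hi' | hi' <;> rcases Nat.lt_or_ge m j with hj' | hj'
    · obtain rfl : i = j := by omega
      simp
    · obtain rfl : i = m + 1 := by omega
      have := key j hj hj'
      have := hf.ne (show j ≠ m + 1 by omega)
      have := hg.ne (show j ≠ m + 1 by omega)
      omega
    · obtain rfl : j = m + 1 := by omega
      exact key i hi hi'
    · exact ih' i j hi hi' hj hj'

theorem natPerm_apply_succ {m : ℕ} (π : Equiv.Perm (Fin m)) (i : Fin m) :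
    natPerm π (i + 1) = π i + 1 :=
  Equiv.Perm.extendDomain_apply_image π (finIccEquiv m) i

/-- The code of a permutation: the sequence of the numbers of smaller preceding entries. -/
def permCode {m : ℕ} (π : Equiv.Perm (Fin m)) (i : ℕ) : ℕ :=
  if i < m then smallerBefore (natPerm π) (i + 1) else 0

theorem permCode_injective (m : ℕ) : Function.Injective (permCode (m := m)) := by
  intro π σ h
  have hord := lt_iff_lt_of_smallerBefore_eq (natPerm π).injective (natPerm σ).injective m
    (fun i h1 h2 => by
      obtain ⟨k, rfl⟩ : ∃ k, i = k + 1 := ⟨i - 1, by omega⟩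
      simpa [permCode, show k < m by omega] using congrFun h k)
  have hlt : ∀ i j : Fin m, π i < π j → σ i < σ j := by
    intro i j hij
    have := (hord (i + 1) (j + 1) (by omega) (by omega) (by omega) (by omega)).1
      (by simpa [natPerm_apply_succ] using hij)
    simpa [natPerm_apply_succ] using this
  have hmono : StrictMono (σ ∘ π.symm) := fun i j hij => hlt _ _ (by simpa using hij)
  have heq : (σ ∘ π.symm : Fin m → Fin m) = id := (hmono.range_inj strictMono_id).1 (by
    rw [(σ.surjective.comp π.symm.surjective).range_eq]; simp)
  ext i
  simpa using congrArg Fin.val (congrFun heq (π i)).symm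

open scoped Classical in
theorem image_permCode (m : ℕ) : univ.image (permCode (m := m)) = codes m := by
  refine eq_of_subset_of_card_le (fun a ha => ?_) ?_
  · obtain ⟨π, -, rfl⟩ := mem_image.1 ha
    refine mem_codes.2 ⟨fun i hi => ?_, fun i hi => ?_⟩
    · rw [permCode, if_pos hi]
      exact Nat.lt_succ_iff.1 (smallerBefore_lt _ (by omega))
    · rw [permCode, if_neg (by omega)]
  · rw [card_codes, card_image_of_injective _ (permCode_injective m), card_univ,
      Fintype.card_perm, Fintype.card_fin]

theorem sum_permCode {M : Type*} [AddCommMonoid M] (m : ℕ) (f : (ℕ → ℕ) → M) :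
    ∑ π : Equiv.Perm (Fin m), f (permCode π) = ∑ a ∈ codes m, f a := by
  classical
  rw [← image_permCode, sum_image (permCode_injective m).injOn]

theorem prod_Icc_succ_eq_prod_Ico {M : Type*} [CommMonoid M] (q m : ℕ) (f : ℕ → M) :
    ∏ i ∈ Icc (q + 1) m, f i = ∏ i ∈ Ico q m, f (i + 1) := by
  have h : Icc (q + 1) m = (Ico q m).image (· + 1) := by
    ext i
    simp only [mem_Icc, mem_image, mem_Ico]
    exact ⟨fun h => ⟨i - 1, by omega⟩, by rintro ⟨j, hj, rfl⟩; omega⟩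
  rw [h, prod_image (add_left_injective 1).injOn]

section Statistics

variable {R : Type*} [CommRing R] {q m : ℕ} (t y : R) (π : Equiv.Perm (Fin m))

theorem pow_card_DelQ (hq : 0 < q) :
    y ^ (DelQ q m (natPerm π)).card = ∏ i ∈ Ico q m, if permCode π i < q then y else 1 := by
  rw [DelQ, ← prod_const, prod_filter, prod_Icc_succ_eq_prod_Ico]
  refine prod_congr rfl fun i hi => ?_
  rw [mem_Ico] at hi
  rw [permCode, if_pos hi.2]
  refine if_congr ?_ rfl rfl
  rw [smallerBefore]
  omega

theorem pow_invQ :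
    t ^ invQ q m (natPerm π) = ∏ i ∈ Ico q m, t ^ min (i + 1 - q) (i - permCode π i) := by
  rw [invQ, ← prod_pow_eq_pow_sum, prod_Icc_succ_eq_prod_Ico]
  refine prod_congr rfl fun i hi => ?_
  rw [mem_Ico] at hi
  rw [permCode, if_pos hi.2, card_filter_lt_of_injective (natPerm π).injective,
    Nat.add_sub_cancel]

theorem DesQ_eq_filter (hq : 0 < q) : DesQ q m (natPerm π) =
    (Ico q m).filter fun i => permCode π i < q ∨ permCode π i ≤ permCode π (i - 1) := by
  have hcode : ∀ i < m, permCode π i = smallerBefore (natPerm π) (i + 1) :=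
    fun i hi => if_pos hi
  have hDel : ∀ i, i ∈ (DelQ q m (natPerm π)).image (fun i => i - 1) ↔
      (q ≤ i ∧ i < m) ∧ smallerBefore (natPerm π) (i + 1) < q := by
    intro i
    simp only [DelQ, mem_image, mem_filter, mem_Icc]
    constructor
    · rintro ⟨j, ⟨hj, hj'⟩, rfl⟩
      obtain ⟨k, rfl⟩ : ∃ k, j = k + 1 := ⟨j - 1, by omega⟩
      rw [Nat.add_sub_cancel, smallerBefore]
      omega
    · rintro ⟨hi, hi'⟩
      rw [smallerBefore] at hi'
      exact ⟨i + 1, ⟨by omega, by omega⟩, by omega⟩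
  ext i
  rw [DesQ, mem_union, hDel]
  simp only [DesSet, mem_inter, mem_filter, mem_Icc, mem_Ico]
  by_cases hi : q ≤ i ∧ i < m
  · rw [hcode i hi.2, hcode (i - 1) (by omega), Nat.sub_add_cancel (by omega),
      apply_succ_lt_iff_smallerBefore_le (natPerm π).injective (by omega)]
    omega
  · omega

theorem pow_rmajQ (hq : 0 < q) :
    t ^ rmajQ q m (natPerm π) = ∏ i ∈ Ico q m,
      if permCode π i < q ∨ permCode π i ≤ permCode π (i - 1) then t ^ (m - i) else 1 := by
  rw [rmajQ, ← prod_pow_eq_pow_sum, DesQ_eq_filter π hq, prod_filter]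

variable (q m)

theorem sum_pow_rmajQ (hq : 0 < q) (hm : q ≤ m) :
    ∑ π : Equiv.Perm (Fin m),
        t ^ rmajQ q m (natPerm π) * y ^ (DelQ q m (natPerm π)).card =
      (q.factorial : R) *
        ∏ j ∈ Icc 1 (m - q), ((∑ i ∈ range j, t ^ i) + t ^ j * y * (q : R)) := by
  simp only [pow_rmajQ t _ hq, pow_card_DelQ y _ hq, ← prod_mul_distrib]
  rw [sum_permCode m fun a => ∏ i ∈ Ico q m,
    (if a i < q ∨ a i ≤ a (i - 1) then t ^ (m - i) else 1) * (if a i < q then y else 1)]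
  refine sum_codes_eq_factorial_mul hq hm
    (fun i c d => (if d < q ∨ d ≤ c then t ^ (m - i) else 1) * (if d < q then y else 1))
    (fun k => codeTail q t y (m - k) k) _ (fun k c _ hkm => ?_)
    (fun c => by simp [codeTail]) fun c hc => codeTail_self q t y _ c hc
  obtain ⟨r, hr⟩ : ∃ r, m - k = r + 1 := ⟨m - k - 1, by omega⟩
  simp only [hr, show m - (k + 1) = r by omega, codeTail, codeStep]
  exact sum_congr rfl fun d _ => by ring

theorem sum_range_pow_min (j : ℕ) :
    ∑ d ∈ range (q + j), t ^ min j (q + j - 1 - d) * (if d < q then y else 1) =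
      (∑ i ∈ range j, t ^ i) + t ^ j * y * (q : R) := by
  rw [sum_range_add, add_comm]
  congr 1
  · rw [← sum_range_reflect]
    refine sum_congr rfl fun d hd => ?_
    rw [mem_range] at hd
    rw [if_neg (by omega), mul_one, min_eq_right (by omega)]
    congr 1
    omega
  · have hterm : ∀ d ∈ range q,
        t ^ min j (q + j - 1 - d) * (if d < q then y else 1) = t ^ j * y := by
      intro d hd
      rw [mem_range] at hd
      rw [if_pos hd, min_eq_left (by omega)]
    rw [sum_congr rfl hterm, sum_const, card_range, nsmul_eq_mul]
    ring

theorem sum_pow_invQ (hq : 0 < q) (hm : q ≤ m) :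
    ∑ π : Equiv.Perm (Fin m),
        t ^ invQ q m (natPerm π) * y ^ (DelQ q m (natPerm π)).card =
      (q.factorial : R) *
        ∏ j ∈ Icc 1 (m - q), ((∑ i ∈ range j, t ^ i) + t ^ j * y * (q : R)) := by
  simp only [pow_invQ t, pow_card_DelQ y _ hq, ← prod_mul_distrib]
  rw [sum_permCode m fun a => ∏ i ∈ Ico q m,
    t ^ min (i + 1 - q) (i - a i) * (if a i < q then y else 1)]
  refine sum_codes_eq_factorial_mul hq hm
    (fun i _ d => t ^ min (i + 1 - q) (i - d) * (if d < q then y else 1))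
    (fun k _ => ∏ j ∈ Ico (k - q + 1) (m - q + 1), ((∑ i ∈ range j, t ^ i) + t ^ j * y * (q : R)))
    _ (fun k c hk hkm => ?_) (fun c => by simp) fun c _ => by
      rw [Nat.sub_self]
      rfl
  obtain ⟨e, rfl⟩ := Nat.exists_eq_add_of_le hk
  have hsum := sum_range_pow_min q t y (e + 1)
  rw [← add_assoc, Nat.add_sub_cancel] at hsum
  rw [← sum_mul, Nat.add_sub_cancel_left, show q + e + 1 - q = e + 1 by omega, hsum,
    prod_eq_prod_Ico_succ_bot (by omega)]

end Statistics

open MvPolynomial in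
/-- For all positive integers `q` and `n`, in `ℤ[t₁,t₂]`:
`Σ_{π ∈ S_{n+q-1}} t₁^{rmaj_{q,n+q-1}(π)} t₂^{#Del_q(π)}
 = Σ_{π ∈ S_{n+q-1}} t₁^{inv_q(π)} t₂^{#Del_q(π)}
 = q! · ∏_{j=1}^{n-1} (1 + t₁ + ⋯ + t₁^{j-1} + t₁^j t₂ q)`. -/
theorem qMacMahon (q n : ℕ) (hq : 0 < q) (hn : 0 < n) :
    (∑ π : Equiv.Perm (Fin (n + q - 1)),
        (X 0 : MvPolynomial (Fin 2) ℤ) ^ rmajQ q (n + q - 1) (natPerm π) *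
          (X 1) ^ (DelQ q (n + q - 1) (natPerm π)).card) =
      (∑ π : Equiv.Perm (Fin (n + q - 1)),
        (X 0 : MvPolynomial (Fin 2) ℤ) ^ invQ q (n + q - 1) (natPerm π) *
          (X 1) ^ (DelQ q (n + q - 1) (natPerm π)).card) ∧
    (∑ π : Equiv.Perm (Fin (n + q - 1)),
        (X 0 : MvPolynomial (Fin 2) ℤ) ^ invQ q (n + q - 1) (natPerm π) *
          (X 1) ^ (DelQ q (n + q - 1) (natPerm π)).card) =
      (Nat.factorial q : MvPolynomial (Fin 2) ℤ) *
        ∏ j ∈ Finset.Icc 1 (n - 1),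
          ((∑ i ∈ Finset.range j, (X 0 : MvPolynomial (Fin 2) ℤ) ^ i) +
            (X 0) ^ j * (X 1) * (q : MvPolynomial (Fin 2) ℤ)) := by
  have hm : q ≤ n + q - 1 := by omega
  have h1 := sum_pow_rmajQ q (n + q - 1) (X 0 : MvPolynomial (Fin 2) ℤ) (X 1) hq hm
  have h2 := sum_pow_invQ q (n + q - 1) (X 0 : MvPolynomial (Fin 2) ℤ) (X 1) hq hm
  rw [show n + q - 1 - q = n - 1 by omega] at h1 h2
  exact ⟨h1.trans h2.symm, h2⟩
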